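/- Let κ > 0, let 0 < T, and let λ : ℝ → ℝ be a function such that λ is differentiable on (0, T) with λ'(r) = λ(r)² + κ² for all r ∈ (0, T), and λ(r) tends to −∞ as r tends to 0 from the right. Then λ(r) = −κ·cot(κr) for all r ∈ (0, min(T, π/κ)). -/

import Mathlib

/-- A solution of `λ' = λ² + κ²` satisfies `(arctan (λ / κ))' = κ`. -/
theorem hasDerivAt_arctan_div_of_riccati {κ r : ℝ} (hκ : κ ≠ 0) {f : ℝ → ℝ}
    (hf : HasDerivAt f ((f r) ^ 2 + κ ^ 2) r) :
    HasDerivAt (fun x => Real.arctan (f x / κ)) κ r := by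
  refine (hf.div_const κ).arctan.congr_deriv ?_
  have h : f r ^ 2 + κ ^ 2 ≠ 0 := by positivity
  have h' : 1 + (f r / κ) ^ 2 = (f r ^ 2 + κ ^ 2) / κ ^ 2 := by
    field_simp
    ring
  rw [h']
  field_simp

/-- Uniqueness for the Riccati equation `λ' = λ² + κ²` with initial condition
`λ(0⁺) = −∞` (emanating from a focal point): any solution on `(0, T)` equals
`−κ·cot(κ r)` on `(0, min T (π/κ))`. -/
theorem riccati_unique_from_focal_point (κ T : ℝ) (hκ : 0 < κ) (hT : 0 < T)
    (f : ℝ → ℝ)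
    (hd : ∀ r ∈ Set.Ioo 0 T, HasDerivAt f ((f r) ^ 2 + κ ^ 2) r)
    (hlim : Filter.Tendsto f (nhdsWithin 0 (Set.Ioi 0)) Filter.atBot) :
    ∀ r ∈ Set.Ioo 0 (min T (Real.pi / κ)),
      f r = -(κ * (Real.cos (κ * r) / Real.sin (κ * r))) := by
  intro r hr
  have hrT : r ∈ Set.Ioo 0 T := ⟨hr.1, hr.2.trans_le (min_le_left _ _)⟩
  set g : ℝ → ℝ := fun x => Real.arctan (f x / κ) - κ * x
  have hgd : ∀ x ∈ Set.Ioo 0 T, HasDerivAt g 0 x := fun x hx =>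
    ((hasDerivAt_arctan_div_of_riccati hκ.ne' (hd x hx)).sub
      ((hasDerivAt_id x).const_mul κ)).congr_deriv (by simp)
  have hconst : ∀ x ∈ Set.Ioo 0 T, g x = g r := fun x hx =>
    isOpen_Ioo.is_const_of_deriv_eq_zero isPreconnected_Ioo
      (fun y hy => (hgd y hy).differentiableAt.differentiableWithinAt)
      (fun y hy => (hgd y hy).deriv) hx hrT
  have hlim_const : Filter.Tendsto g (nhdsWithin 0 (Set.Ioi 0)) (nhds (g r)) := by
    refine tendsto_const_nhds.congr' ?_
    filter_upwards [Ioo_mem_nhdsGT hT] with x hx using (hconst x hx).symm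
  have hlim_g : Filter.Tendsto g (nhdsWithin 0 (Set.Ioi 0)) (nhds (-(Real.pi / 2) - κ * 0)) :=
    ((Real.tendsto_arctan_atBot.mono_right nhdsWithin_le_nhds).comp
      (hlim.atBot_div_const hκ)).sub
      ((continuous_const_mul κ).continuousAt.tendsto.mono_left nhdsWithin_le_nhds)
  have harctan : Real.arctan (f r / κ) = -(Real.pi / 2 - κ * r) := by
    have h : Real.arctan (f r / κ) - κ * r = -(Real.pi / 2) - κ * 0 :=
      tendsto_nhds_unique hlim_const hlim_g
    linarith
  have hdiv : f r / κ = -(Real.cos (κ * r) / Real.sin (κ * r)) := by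
    rw [← Real.tan_arctan (f r / κ), harctan, Real.tan_neg, Real.tan_pi_div_two_sub,
      Real.tan_eq_sin_div_cos, inv_div]
  rw [← mul_neg, ← hdiv, mul_div_cancel₀ _ hκ.ne']
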